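/- arXiv:2302.04402 — 2 statements merged into one kernel-verified Lean document; each statement's English description precedes it below -/
import Mathlib

section
/- Let B_𝒥 be a non-degenerate Grothendieck Boolean algebra. For any set X, there is a bijection between 𝕋_{B_𝒥}-model structures on X and B_𝒥-set structures on X, under which: the B-set operation is b(x,y) = ⟦ω_b⟧(x,y) for the distribution ω_b on {1,2} with ω_b(1) = b, ω_b(2) = bᶜ; the partition operation for infinite P ∈ 𝒥 is the interpretation of the distribution given by the inclusion P ↪ B; and a function between two such sets is a 𝕋_{B_𝒥}-model homomorphism if and only if it is a B_𝒥-set homomorphism. -/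
/-- A `B`-set structure on `X`, for a Boolean algebra `B`. -/
structure BSetStruct (B : Type) [BooleanAlgebra B] (X : Type) where
  act : B → X → X → X
  act_refl : ∀ b x, act b x x = x
  act_absorb_left : ∀ b x y z, act b (act b x y) z = act b x z
  act_absorb_right : ∀ b x y z, act b x (act b y z) = act b x z
  act_top : ∀ x y, act ⊤ x y = x
  act_compl : ∀ b x y, act bᶜ x y = act b y x
  act_inf : ∀ b c x y, act (b ⊓ c) x y = act b (act c x y) y

/-- The relation `x ≡_b y`, i.e. `b(x,y) = y`. -/
def BSetStruct.eqv {B X : Type} [BooleanAlgebra B] (S : BSetStruct B X)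
    (b : B) (x y : X) : Prop :=
  S.act b x y = y

/-- A homomorphism of `B`-sets. -/
def IsBSetHom {B X Y : Type} [BooleanAlgebra B]
    (SX : BSetStruct B X) (SY : BSetStruct B Y) (f : X → Y) : Prop :=
  ∀ b x y, f (SX.act b x y) = SY.act b (f x) (f y)

/-- `P` is a partition of `b`: a set of nonzero pairwise-disjoint elements
whose supremum exists and equals `b`. -/
def IsPartitionOf {B : Type} [BooleanAlgebra B] (P : Set B) (b : B) : Prop :=
  (∀ c ∈ P, c ≠ ⊥) ∧ (∀ c ∈ P, ∀ d ∈ P, c ≠ d → c ⊓ d = ⊥) ∧ IsLUB P b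

/-- A zero-dimensional topology on a Boolean algebra `B`: a collection `J` of
partitions of `1` containing all finite partitions, closed under refinement and
under images along surjections. -/
structure ZeroDimTopology (B : Type) [BooleanAlgebra B] where
  J : Set (Set B)
  partitions : ∀ P ∈ J, IsPartitionOf P ⊤
  finite_mem : ∀ P : Set B, IsPartitionOf P ⊤ → P.Finite → P ∈ J
  refine : ∀ P ∈ J, ∀ Q : B → Set B, (∀ b ∈ P, Q b ∈ J) →
      ({d : B | ∃ b ∈ P, ∃ c ∈ Q b, d = b ⊓ c} \ {⊥}) ∈ J
  glue : ∀ (P : Set B), P ∈ J → ∀ (I : Type) (α : P → I), Function.Surjective α →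
      (∀ i : I, ∃ s : B, IsLUB (Subtype.val '' (α ⁻¹' {i})) s) ∧
      {s : B | ∃ i : I, IsLUB (Subtype.val '' (α ⁻¹' {i})) s} ∈ J

/-- A `B_𝒥`-set: a `B`-set together with an operation `X^P → X` for each
infinite partition `P ∈ 𝒥`, satisfying the three axioms. -/
structure BJSetStruct (B : Type) [BooleanAlgebra B] (𝒥 : ZeroDimTopology B)
    (X : Type) extends BSetStruct B X where
  pop : ∀ (P : Set B), P ∈ 𝒥.J → P.Infinite → (P → X) → X
  pop_const : ∀ (P : Set B) (hP : P ∈ 𝒥.J) (hinf : P.Infinite) (x : X),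
      pop P hP hinf (fun _ => x) = x
  pop_act : ∀ (P : Set B) (hP : P ∈ 𝒥.J) (hinf : P.Infinite) (x y : P → X),
      pop P hP hinf (fun b => act b.1 (x b) (y b)) = pop P hP hinf x
  act_pop : ∀ (P : Set B) (hP : P ∈ 𝒥.J) (hinf : P.Infinite) (x : P → X) (b : P),
      act b.1 (pop P hP hinf x) (x b) = x b

/-- A homomorphism of `B_𝒥`-sets is just a homomorphism of the underlying
`B`-sets. -/
def IsBJSetHom {B X Y : Type} [BooleanAlgebra B] {𝒥 : ZeroDimTopology B}
    (SX : BJSetStruct B 𝒥 X) (SY : BJSetStruct B 𝒥 Y) (f : X → Y) : Prop :=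
  IsBSetHom SX.toBSetStruct SY.toBSetStruct f

/-- `ω : I → B` is a `B_𝒥`-valued distribution: its restriction to its
support is injective, with image a partition in `𝒥`. -/
def IsDistribOn {B : Type} [BooleanAlgebra B] (𝒥 : ZeroDimTopology B)
    {I : Type} (ω : I → B) : Prop :=
  Set.InjOn ω {i | ω i ≠ ⊥} ∧ ω '' {i | ω i ≠ ⊥} ∈ 𝒥.J

/-- A model structure for the theory `𝕋_{B_𝒥}` of `B_𝒥`-sets on the set `X`:
an interpretation of every `B_𝒥`-valued distribution, respecting the
projections and the substitution of the theory `𝕋_{B_𝒥}` (where the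
substitution `ω(γ)` is characterised by `ω(γ)(j) = ⨆_{i} ω(i) ⊓ γ_i(j)`). -/
structure BJModel (B : Type) [BooleanAlgebra B] (𝒥 : ZeroDimTopology B)
    (X : Type) where
  int : ∀ {I : Type} (ω : I → B), IsDistribOn 𝒥 ω → (I → X) → X
  int_pr : ∀ {I : Type} (i : I) (ω : I → B) (h : IsDistribOn 𝒥 ω),
      ω i = ⊤ → (∀ j : I, j ≠ i → ω j = ⊥) →
      ∀ x : I → X, int ω h x = x i
  int_subst : ∀ {I J : Type} (ω : I → B) (hω : IsDistribOn 𝒥 ω)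
      (γ : I → J → B) (hγ : ∀ i, IsDistribOn 𝒥 (γ i))
      (ρ : J → B) (hρ : IsDistribOn 𝒥 ρ),
      (∀ j : J, IsLUB (Set.range fun i => ω i ⊓ γ i j) (ρ j)) →
      ∀ x : J → X, int ρ hρ x = int ω hω (fun i => int (γ i) (hγ i) x)

/-- A homomorphism of `𝕋_{B_𝒥}`-models. -/
def IsBJModelHom {B X Y : Type} [BooleanAlgebra B] {𝒥 : ZeroDimTopology B}
    (SX : BJModel B 𝒥 X) (SY : BJModel B 𝒥 Y) (f : X → Y) : Prop :=
  ∀ (I : Type) (ω : I → B) (h : IsDistribOn 𝒥 ω) (x : I → X),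
    f (SX.int ω h x) = SY.int ω h (fun i => f (x i))

namespace BSetStruct

variable {B X : Type} [BooleanAlgebra B] (S : BSetStruct B X)

theorem eqv_symm {b : B} {x y : X} (h : S.eqv b x y) : S.eqv b y x := by
  unfold eqv at *
  rw [← h, S.act_absorb_left, S.act_refl]

theorem eqv_trans {b : B} {x y z : X} (h : S.eqv b x y) (h' : S.eqv b y z) :
    S.eqv b x z := by
  unfold eqv at *
  rw [← S.act_absorb_left b x y z, h, h']

theorem eqv_mono {b c : B} {x y : X} (hcb : c ≤ b) (h : S.eqv b x y) : S.eqv c x y := by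
  unfold eqv at *
  rw [← inf_eq_left.2 hcb, S.act_inf, h, S.act_refl]

theorem eqv_bot (x y : X) : S.eqv ⊥ x y := by
  unfold eqv
  rw [← compl_top, S.act_compl, S.act_top]

theorem eq_of_eqv_top {x y : X} (h : S.eqv ⊤ x y) : x = y := by
  rw [← S.act_top x y]
  exact h

theorem eqv_sup {b c : B} {x y : X} (hb : S.eqv b x y) (hc : S.eqv c x y) :
    S.eqv (b ⊔ c) x y := by
  unfold eqv at *
  rw [← compl_compl (b ⊔ c), compl_sup, S.act_compl, S.act_inf, S.act_compl c, hc,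
    S.act_compl, hb]

theorem act_eqv_left (b : B) (x y : X) : S.eqv b (S.act b x y) x := by
  unfold eqv
  rw [S.act_absorb_left, S.act_refl]

theorem act_eqv_right (b : B) (x y : X) : S.eqv bᶜ (S.act b x y) y := by
  unfold eqv
  rw [S.act_compl, S.act_absorb_right, S.act_refl]

theorem eqv_finset_sup {x y : X} (s : Finset B) (h : ∀ b ∈ s, S.eqv b x y) :
    S.eqv (s.sup id) x y :=
  Finset.sup_induction (p := fun b => S.eqv b x y) (S.eqv_bot x y)
    (fun _ ha _ hb => S.eqv_sup ha hb) h

theorem exists_glue_finset [Nonempty X] {I : Type} (ω : I → B)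
    (hω : ∀ i j, i ≠ j → ω i ⊓ ω j = ⊥) (x : I → X) (s : Finset I) :
    ∃ z, ∀ i ∈ s, S.eqv (ω i) z (x i) := by
  classical
  induction s using Finset.induction_on with
  | empty => exact ⟨Classical.arbitrary X, by simp⟩
  | insert a s ha ih =>
    obtain ⟨z, hz⟩ := ih
    refine ⟨S.act (ω a) (x a) z, fun i hi => ?_⟩
    by_cases hia : i = a
    · subst hia
      exact S.act_eqv_left _ _ _
    · refine S.eqv_trans (S.eqv_mono ?_ (S.act_eqv_right (ω a) (x a) z))
        (hz i (Finset.mem_of_mem_insert_of_ne hi hia))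
      exact (disjoint_iff.2 (hω i a hia)).le_compl_right

end BSetStruct

theorem isLUB_range_of_eq_bot {B I : Type} [BooleanAlgebra B] (f : I → B) (i : I)
    (h : ∀ j, j ≠ i → f j = ⊥) : IsLUB (Set.range f) (f i) := by
  refine IsGreatest.isLUB ⟨⟨i, rfl⟩, ?_⟩
  rintro _ ⟨j, rfl⟩
  by_cases hj : j = i
  · rw [hj]
  · simp [h j hj]

theorem isLUB_range_bool {B : Type} [BooleanAlgebra B] (f : Bool → B) :
    IsLUB (Set.range f) (f true ⊔ f false) := by
  rw [Bool.range_eq, Set.pair_comm]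
  exact isLUB_pair

section Distributions

variable {B I J : Type} [BooleanAlgebra B] {𝒥 : ZeroDimTopology B}

theorem isLUB_range_iff_support (ω : I → B) (b : B) :
    IsLUB (ω '' {i | ω i ≠ ⊥}) b ↔ IsLUB (Set.range ω) b := by
  have : upperBounds (ω '' {i | ω i ≠ ⊥}) = upperBounds (Set.range ω) := by
    ext c
    constructor
    · rintro h _ ⟨i, rfl⟩
      by_cases hi : ω i = ⊥
      · simp [hi]
      · exact h ⟨i, hi, rfl⟩
    · exact fun h => upperBounds_mono_set (Set.image_subset_range _ _) h
  rw [IsLUB, IsLUB, this]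

theorem IsDistribOn.inf_eq_bot {ω : I → B} (h : IsDistribOn 𝒥 ω) {i j : I} (hij : i ≠ j) :
    ω i ⊓ ω j = ⊥ := by
  by_cases hi : ω i = ⊥
  · simp [hi]
  by_cases hj : ω j = ⊥
  · simp [hj]
  exact (𝒥.partitions _ h.2).2.1 _ ⟨i, hi, rfl⟩ _ ⟨j, hj, rfl⟩ fun e => hij (h.1 hi hj e)

theorem IsDistribOn.isLUB {ω : I → B} (h : IsDistribOn 𝒥 ω) : IsLUB (Set.range ω) ⊤ :=
  (isLUB_range_iff_support ω ⊤).1 (𝒥.partitions _ h.2).2.2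

theorem IsDistribOn.of_finite {ω : I → B} (hd : ∀ i j, i ≠ j → ω i ⊓ ω j = ⊥)
    (hl : IsLUB (Set.range ω) ⊤) (hf : (Set.range ω).Finite) : IsDistribOn 𝒥 ω := by
  refine ⟨fun i hi j _ e => ?_, 𝒥.finite_mem _ ⟨?_, ?_, (isLUB_range_iff_support ω ⊤).2 hl⟩
    (hf.subset (Set.image_subset_range _ _))⟩
  · by_contra hij
    have := hd i j hij
    rw [← e, inf_idem] at this
    exact hi this
  · rintro _ ⟨i, hi, rfl⟩
    exact hi
  · rintro _ ⟨i, hi, rfl⟩ _ ⟨j, hj, rfl⟩ hij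
    exact hd i j fun e => hij (e ▸ rfl)

theorem isDistribOn_val {P : Set B} (hP : P ∈ 𝒥.J) :
    IsDistribOn 𝒥 (Subtype.val : P → B) := by
  refine ⟨Subtype.val_injective.injOn, ?_⟩
  have : {i : P | i.1 ≠ ⊥} = Set.univ :=
    Set.eq_univ_of_forall fun i => (𝒥.partitions P hP).1 i.1 i.2
  rwa [this, Set.image_univ, Subtype.range_coe]

/-- The two-valued distribution `(b, bᶜ)`. -/
def cut (b : B) : Bool → B := fun i => if i then b else bᶜ

theorem isDistribOn_cut (𝒥 : ZeroDimTopology B) (b : B) : IsDistribOn 𝒥 (cut b) := by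
  refine .of_finite ?_ ?_ (Set.finite_range _)
  · intro i j hij
    cases i <;> cases j <;> simp [cut] at hij ⊢
  · simpa [cut] using isLUB_range_bool (cut b)

open Classical in
/-- The projection `π_i`, as a distribution. -/
noncomputable def dirac (B : Type) [BooleanAlgebra B] {I : Type} (i : I) : I → B :=
  fun j => if j = i then ⊤ else ⊥

@[simp] theorem dirac_self (i : I) : dirac B i i = ⊤ := if_pos rfl

theorem dirac_of_ne {i j : I} (h : j ≠ i) : dirac B i j = ⊥ := if_neg h

theorem isDistribOn_dirac (𝒥 : ZeroDimTopology B) (i : I) : IsDistribOn 𝒥 (dirac B i) := by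
  refine .of_finite ?_ ?_ ?_
  · intro j k hjk
    by_cases hj : j = i
    · rw [dirac_of_ne (j := k) fun hk => hjk (hj.trans hk.symm), inf_bot_eq]
    · rw [dirac_of_ne hj, bot_inf_eq]
  · simpa using isLUB_range_of_eq_bot (dirac B i) i fun j => dirac_of_ne
  · refine (Set.toFinite {⊤, ⊥}).subset ?_
    rintro _ ⟨j, rfl⟩
    by_cases hj : j = i
    · simp [hj]
    · simp [dirac_of_ne hj]

/-- The pushforward of a distribution along an injection. -/
noncomputable def extendBot (σ : I → J) (ω : I → B) : J → B := Function.extend σ ω ⊥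

theorem extendBot_apply {σ : I → J} (hσ : σ.Injective) (ω : I → B) (i : I) :
    extendBot σ ω (σ i) = ω i := hσ.extend_apply ..

theorem extendBot_of_notMem {σ : I → J} (ω : I → B) {j : J} (hj : ∀ i, σ i ≠ j) :
    extendBot σ ω j = ⊥ :=
  Function.extend_apply' _ _ _ fun ⟨i, hi⟩ => hj i hi

theorem IsDistribOn.extendBot {ω : I → B} (h : IsDistribOn 𝒥 ω) {σ : I → J}
    (hσ : σ.Injective) : IsDistribOn 𝒥 (extendBot σ ω) := by
  have hs : {j | _root_.extendBot σ ω j ≠ ⊥} = σ '' {i | ω i ≠ ⊥} := by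
    ext j
    constructor
    · intro hj
      by_cases hj' : ∃ i, σ i = j
      · obtain ⟨i, rfl⟩ := hj'
        exact ⟨i, by simpa [extendBot_apply hσ] using hj, rfl⟩
      · exact absurd (extendBot_of_notMem ω fun i hi => hj' ⟨i, hi⟩) hj
    · rintro ⟨i, hi, rfl⟩
      simpa [extendBot_apply hσ] using hi
  unfold IsDistribOn
  rw [hs]
  constructor
  · rintro _ ⟨i, hi, rfl⟩ _ ⟨j, hj, rfl⟩ e
    rw [extendBot_apply hσ, extendBot_apply hσ] at e
    rw [h.1 hi hj e]
  · rw [Set.image_image]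
    simpa [extendBot_apply hσ] using h.2

end Distributions

namespace BJModel

variable {B X : Type} [BooleanAlgebra B] {𝒥 : ZeroDimTopology B}

theorem ext_int {S T : BJModel B 𝒥 X}
    (h : ∀ (I : Type) (ω : I → B) (hω : IsDistribOn 𝒥 ω) (x : I → X),
      S.int ω hω x = T.int ω hω x) : S = T := by
  cases S
  cases T
  congr
  funext I ω hω x
  exact h I ω hω x

variable (S : BJModel B 𝒥 X)

theorem int_congr {I : Type} {ω ω' : I → B} (e : ω = ω') (h : IsDistribOn 𝒥 ω)
    (h' : IsDistribOn 𝒥 ω') (x : I → X) : S.int ω h x = S.int ω' h' x := by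
  subst e
  rfl

theorem int_dirac {I : Type} (i : I) (x : I → X) :
    S.int (dirac B i) (isDistribOn_dirac 𝒥 i) x = x i :=
  S.int_pr i _ _ (dirac_self i) (fun _ => dirac_of_ne) x

theorem int_const {I : Type} (ω : I → B) (h : IsDistribOn 𝒥 ω) (x : X) :
    S.int ω h (fun _ => x) = x := by
  have := S.int_subst ω h (fun _ => dirac B ()) (fun _ => isDistribOn_dirac 𝒥 ())
    (dirac B ()) (isDistribOn_dirac 𝒥 ()) (fun _ => by simpa using h.isLUB) (fun _ => x)
  simpa [int_dirac] using this.symm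

theorem int_extendBot {I J : Type} (ω : I → B) (h : IsDistribOn 𝒥 ω) {σ : I → J}
    (hσ : σ.Injective) (x : J → X) :
    S.int (extendBot σ ω) (h.extendBot hσ) x = S.int ω h (x ∘ σ) := by
  rw [S.int_subst ω h (fun i => dirac B (σ i)) (fun i => isDistribOn_dirac 𝒥 _)
    (extendBot σ ω) (h.extendBot hσ) ?_ x]
  · simp only [int_dirac]
    rfl
  · intro j
    by_cases hj : ∃ i, σ i = j
    · obtain ⟨i, rfl⟩ := hj
      have := isLUB_range_of_eq_bot (fun k => ω k ⊓ dirac B (σ k) (σ i)) i fun k hk => by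
        simp [dirac_of_ne fun e => hk (hσ e).symm]
      simpa [extendBot_apply hσ] using this
    · have hj' : ∀ i, σ i ≠ j := fun i hi => hj ⟨i, hi⟩
      rw [extendBot_of_notMem ω hj']
      refine ⟨?_, fun _ _ => bot_le⟩
      rintro _ ⟨i, rfl⟩
      simp [dirac_of_ne (hj' i).symm]

/-- The operation `b(x,y)` of a model. -/
def act (b : B) (x y : X) : X :=
  S.int (cut b) (isDistribOn_cut 𝒥 b) fun i => if i then x else y

theorem int_act {I : Type} (ω : I → B) (h : IsDistribOn 𝒥 ω) (x y : I → X) :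
    S.int ω h (fun i => S.act (ω i) (x i) (y i)) = S.int ω h x := by
  have hl : (fun i : I => (i, true)).Injective := Prod.mk_left_injective true
  have hr (i : I) : (Prod.mk i : Bool → I × Bool).Injective := Prod.mk_right_injective i
  let v : I × Bool → X := fun p => if p.2 then x p.1 else y p.1
  have key := S.int_subst ω h (fun i => extendBot (Prod.mk i) (cut (ω i)))
    (fun i => (isDistribOn_cut 𝒥 (ω i)).extendBot (hr i))
    (extendBot (fun i : I => (i, true)) ω) (h.extendBot hl) ?_ v
  · refine ((S.int_extendBot ω h hl v).symm.trans (key.trans ?_)).symm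
    congr 1
    funext i
    exact S.int_extendBot _ (isDistribOn_cut 𝒥 (ω i)) (hr i) v
  · rintro ⟨i, t⟩
    have := isLUB_range_of_eq_bot
      (fun k => ω k ⊓ extendBot (Prod.mk k) (cut (ω k)) (i, t)) i fun k hk => by
        rw [extendBot_of_notMem _ fun u e => hk (congrArg Prod.fst e), inf_bot_eq]
    convert this using 1
    rw [extendBot_apply (hr i)]
    cases t
    · rw [extendBot_of_notMem _ fun u e => by simpa using congrArg Prod.snd e]
      simp [cut]
    · rw [extendBot_apply hl]
      simp [cut]

theorem act_int {I : Type} (ω : I → B) (h : IsDistribOn 𝒥 ω) (x : I → X) (i : I) :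
    S.act (ω i) (S.int ω h x) (x i) = x i := by
  let γ : Bool → I → B := fun t => if t then ω else dirac B i
  have hγ (t : Bool) : IsDistribOn 𝒥 (γ t) := by
    cases t
    · exact isDistribOn_dirac 𝒥 i
    · exact h
  have key := S.int_subst (cut (ω i)) (isDistribOn_cut 𝒥 _) γ hγ (dirac B i)
    (isDistribOn_dirac 𝒥 i) ?_ x
  · rw [int_dirac] at key
    conv_rhs => rw [key]
    unfold act
    congr 1
    funext t
    cases t
    · exact (S.int_dirac i x).symm
    · rfl
  · intro j
    convert isLUB_range_bool _ using 1
    by_cases hj : j = i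
    · subst hj
      simp [γ, cut]
    · simp [γ, cut, dirac_of_ne hj, h.inf_eq_bot (Ne.symm hj)]

theorem act_self (b : B) (x : X) : S.act b x x = x := by
  simpa [act] using S.int_const (cut b) (isDistribOn_cut 𝒥 b) x

theorem act_compl (b : B) (x y : X) : S.act bᶜ x y = S.act b y x := by
  have hn : Function.Injective Bool.not := Bool.involutive_not.injective
  have e : extendBot Bool.not (cut b) = cut bᶜ := by
    funext t
    obtain ⟨u, rfl⟩ : ∃ u, Bool.not u = t := ⟨!t, Bool.not_not t⟩
    rw [extendBot_apply hn]
    cases u <;> simp [cut]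
  unfold act
  rw [S.int_congr e.symm _ ((isDistribOn_cut 𝒥 b).extendBot hn),
    S.int_extendBot _ (isDistribOn_cut 𝒥 b) hn]
  congr 1
  funext t
  cases t <;> rfl

theorem act_inf (b c : B) (x y : X) :
    S.act (b ⊓ c) x y = S.act b (S.act c x y) y := by
  let γ : Bool → Bool → B := fun t => if t then cut c else dirac B false
  have hγ (t : Bool) : IsDistribOn 𝒥 (γ t) := by
    cases t
    · exact isDistribOn_dirac 𝒥 false
    · exact isDistribOn_cut 𝒥 c
  refine (S.int_subst (cut b) (isDistribOn_cut 𝒥 b) γ hγ (cut (b ⊓ c))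
    (isDistribOn_cut 𝒥 _) ?_ _).trans ?_
  · intro j
    convert isLUB_range_bool _ using 1
    cases j
    · simp only [γ, cut, Bool.false_eq_true, if_false, if_true, dirac_self, inf_top_eq, compl_inf]
      rw [sup_comm bᶜ, sup_comm (b ⊓ cᶜ), sup_inf_left]
      simp [sup_comm]
    · simp [γ, cut, dirac_of_ne]
  · unfold act
    congr 1
    funext t
    cases t
    · exact S.int_dirac false _
    · rfl

theorem act_absorb (b : B) (x y z w : X) :
    S.act b (S.act b x y) (S.act b z w) = S.act b x w := by
  have := S.int_act (cut b) (isDistribOn_cut 𝒥 b) (fun t => if t then x else w)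
    (fun t => if t then y else z)
  refine Eq.trans ?_ this
  conv_lhs => unfold act
  congr 1
  funext t
  cases t
  · exact (S.act_compl b w z).symm
  · rfl

/-- The `B_𝒥`-set underlying a model. -/
def toBJSet : BJSetStruct B 𝒥 X where
  act := S.act
  act_refl := S.act_self
  act_absorb_left b x y z := by
    simpa [act_self] using S.act_absorb b x y z z
  act_absorb_right b x y z := by
    simpa [act_self] using S.act_absorb b x x y z
  act_top x y := S.int_pr true _ _ (by simp [cut]) (by simp [cut]) _
  act_compl := S.act_compl
  act_inf := S.act_inf
  pop P hP _ x := S.int (Subtype.val : P → B) (isDistribOn_val hP) x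
  pop_const _ _ _ x := S.int_const _ _ x
  pop_act _ _ _ x y := S.int_act _ _ x y
  act_pop _ _ _ x b := S.act_int _ _ x b

end BJModel

namespace BJSetStruct

variable {B X : Type} [BooleanAlgebra B] {𝒥 : ZeroDimTopology B}

theorem ext_ops {S T : BJSetStruct B 𝒥 X} (ha : ∀ b x y, S.act b x y = T.act b x y)
    (hp : ∀ P hP hinf x, S.pop P hP hinf x = T.pop P hP hinf x) : S = T := by
  obtain ⟨⟨a, _, _, _, _, _, _⟩, p, _, _, _⟩ := S
  obtain ⟨⟨a', _, _, _, _, _, _⟩, p', _, _, _⟩ := T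
  obtain rfl : a = a' := by
    funext b x y
    exact ha b x y
  obtain rfl : p = p' := by
    funext P hP hinf x
    exact hp P hP hinf x
  rfl

variable (S : BJSetStruct B 𝒥 X)

theorem eq_of_forall_mem_eqv {P : Set B} (hP : P ∈ 𝒥.J) {x y : X}
    (h : ∀ b ∈ P, S.eqv b x y) : x = y := by
  by_cases hf : P.Finite
  · have h1 := S.eqv_finset_sup hf.toFinset fun b hb => h b (hf.mem_toFinset.1 hb)
    have h2 : hf.toFinset.sup id = ⊤ := by
      refine top_le_iff.1 ((𝒥.partitions P hP).2.2.2 fun b hb => ?_)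
      exact Finset.le_sup (f := id) (hf.mem_toFinset.2 hb)
    rw [h2] at h1
    exact S.eq_of_eqv_top h1
  · rw [← S.pop_const P hP hf x, ← S.pop_act P hP hf (fun _ => x) (fun _ => y)]
    rw [show (fun b : P => S.act b.1 x y) = fun _ => y from funext fun b => h b.1 b.2]
    exact S.pop_const P hP hf y

theorem eq_of_forall_eqv {I : Type} {ω : I → B} (h : IsDistribOn 𝒥 ω) {x y : X}
    (hxy : ∀ i, S.eqv (ω i) x y) : x = y := by
  refine S.eq_of_forall_mem_eqv h.2 ?_
  rintro _ ⟨i, -, rfl⟩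
  exact hxy i

theorem eq_of_glue {I : Type} {ω : I → B} (h : IsDistribOn 𝒥 ω) {x : I → X} {z w : X}
    (hz : ∀ i, S.eqv (ω i) z (x i)) (hw : ∀ i, S.eqv (ω i) w (x i)) : z = w :=
  S.eq_of_forall_eqv h fun i => S.eqv_trans (hz i) (S.eqv_symm (hw i))

theorem exists_glue (nondeg : (⊥ : B) ≠ ⊤) {I : Type} {ω : I → B} (h : IsDistribOn 𝒥 ω)
    (x : I → X) : ∃ z, ∀ i, S.eqv (ω i) z (x i) := by
  classical
  by_cases hf : (ω '' {i | ω i ≠ ⊥}).Finite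
  · have hs : {i | ω i ≠ ⊥}.Finite := hf.of_finite_image h.1
    have : Nonempty I := by
      by_contra hI
      rw [not_nonempty_iff] at hI
      have := h.isLUB
      rw [Set.range_eq_empty, isLUB_empty_iff] at this
      exact nondeg (top_le_iff.1 (this ⊥))
    have : Nonempty X := this.map x
    obtain ⟨z, hz⟩ := S.exists_glue_finset ω (fun i j => h.inf_eq_bot) x hs.toFinset
    refine ⟨z, fun i => ?_⟩
    by_cases hi : ω i = ⊥
    · rw [hi]
      exact S.eqv_bot _ _
    · exact hz i (hs.mem_toFinset.2 hi)
  · choose g hg hωg using fun b : ω '' {i | ω i ≠ ⊥} => b.2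
    refine ⟨S.pop _ h.2 hf fun b => x (g b), fun i => ?_⟩
    by_cases hi : ω i = ⊥
    · rw [hi]
      exact S.eqv_bot _ _
    · have := S.act_pop _ h.2 hf (fun b => x (g b)) ⟨ω i, i, hi, rfl⟩
      rwa [h.1 (hg _) hi (hωg ⟨ω i, i, hi, rfl⟩)] at this

/-- The model underlying a `B_𝒥`-set: a distribution acts by gluing. -/
noncomputable def toModel (nondeg : (⊥ : B) ≠ ⊤) : BJModel B 𝒥 X where
  int _ h x := (S.exists_glue nondeg h x).choose
  int_pr i ω h hi _ x := by
    have := (S.exists_glue nondeg h x).choose_spec i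
    rw [hi] at this
    exact S.eq_of_eqv_top this
  int_subst ω hω γ hγ ρ hρ hl x := by
    have hz := (S.exists_glue nondeg hρ x).choose_spec
    have hu := fun i => (S.exists_glue nondeg (hγ i) x).choose_spec
    have hw := (S.exists_glue nondeg hω fun i =>
      (S.exists_glue nondeg (hγ i) x).choose).choose_spec
    refine S.eq_of_forall_eqv hω fun i => S.eq_of_forall_eqv (hγ i) fun j => ?_
    have h1 : S.eqv (ω i ⊓ γ i j) _ _ := S.eqv_mono ((hl j).1 ⟨i, rfl⟩) (hz j)
    have h2 := S.eqv_trans (S.eqv_mono inf_le_left (hw i)) (S.eqv_mono inf_le_right (hu i j))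
    have h3 := S.eqv_trans h1 (S.eqv_symm h2)
    rw [inf_comm] at h3
    exact (S.act_inf ..).symm.trans h3

theorem toModel_glue (nondeg : (⊥ : B) ≠ ⊤) {I : Type} {ω : I → B} (h : IsDistribOn 𝒥 ω)
    (x : I → X) (i : I) : S.eqv (ω i) ((S.toModel nondeg).int ω h x) (x i) :=
  (S.exists_glue nondeg h x).choose_spec i

end BJSetStruct

theorem BJModel.toModel_toBJSet {B X : Type} [BooleanAlgebra B] {𝒥 : ZeroDimTopology B}
    (nondeg : (⊥ : B) ≠ ⊤) (S : BJModel B 𝒥 X) : S.toBJSet.toModel nondeg = S :=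
  BJModel.ext_int fun _ ω hω x => S.toBJSet.eq_of_glue hω
    (S.toBJSet.toModel_glue nondeg hω x) (S.act_int ω hω x)

theorem BJSetStruct.toBJSet_toModel {B X : Type} [BooleanAlgebra B] {𝒥 : ZeroDimTopology B}
    (nondeg : (⊥ : B) ≠ ⊤) (S : BJSetStruct B 𝒥 X) : (S.toModel nondeg).toBJSet = S := by
  refine BJSetStruct.ext_ops (fun b x y => ?_) fun P hP hinf x => ?_
  · refine S.eq_of_glue (isDistribOn_cut 𝒥 b)
      (S.toModel_glue nondeg (isDistribOn_cut 𝒥 b) _) fun t => ?_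
    cases t
    · exact S.act_eqv_right b x y
    · exact S.act_eqv_left b x y
  · exact S.eq_of_glue (isDistribOn_val hP) (S.toModel_glue nondeg (isDistribOn_val hP) x)
      (S.act_pop P hP hinf x)

theorem isBJModelHom_iff {B X Y : Type} [BooleanAlgebra B] {𝒥 : ZeroDimTopology B}
    (SX : BJModel B 𝒥 X) (SY : BJModel B 𝒥 Y) (f : X → Y) :
    IsBJModelHom SX SY f ↔ IsBJSetHom SX.toBJSet SY.toBJSet f := by
  constructor
  · intro h b x y
    refine (h _ (cut b) (isDistribOn_cut 𝒥 b) _).trans ?_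
    change _ = SY.act b (f x) (f y)
    unfold BJModel.act
    congr 1
    funext t
    cases t <;> rfl
  · intro h I ω hω x
    refine SY.toBJSet.eq_of_glue hω (fun i => ?_) (SY.act_int ω hω _)
    exact (h (ω i) _ _).symm.trans (congrArg f (SX.act_int ω hω x i))

/-- For every set `X` there is a bijection between `𝕋_{B_𝒥}`-model structures
and `B_𝒥`-set structures on `X`, under which the `B`-set operation is the
interpretation of the distribution `ω_b = (b, bᶜ)`, the partition operation of
an infinite `P ∈ 𝒥` is the interpretation of the inclusion `P ↪ B`, and the
homomorphisms of models are exactly the homomorphisms of `B_𝒥`-sets. -/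
theorem bjmodel_equiv_bjset (B : Type) [BooleanAlgebra B]
    (nondeg : (⊥ : B) ≠ ⊤) (𝒥 : ZeroDimTopology B) :
    ∃ e : ∀ X : Type, BJModel B 𝒥 X ≃ BJSetStruct B 𝒥 X,
      -- the `B`-set operations
      (∀ (X : Type) (S : BJModel B 𝒥 X) (b : B) (x y : X)
          (h : IsDistribOn 𝒥 (fun i : Bool => if i then b else bᶜ)),
        (e X S).toBSetStruct.act b x y =
          S.int (fun i : Bool => if i then b else bᶜ) h
            (fun i : Bool => if i then x else y)) ∧
      -- the partition operations
      (∀ (X : Type) (S : BJModel B 𝒥 X) (P : Set B) (hP : P ∈ 𝒥.J)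
          (hinf : P.Infinite) (h : IsDistribOn 𝒥 (Subtype.val : P → B))
          (x : P → X),
        (e X S).pop P hP hinf x = S.int (Subtype.val : P → B) h x) ∧
      -- homomorphisms correspond
      (∀ (X Y : Type) (SX : BJModel B 𝒥 X) (SY : BJModel B 𝒥 Y) (f : X → Y),
        IsBJModelHom SX SY f ↔ IsBJSetHom (e X SX) (e Y SY) f) := by
  exact ⟨fun X => ⟨BJModel.toBJSet, fun S => S.toModel nondeg,
      fun S => S.toModel_toBJSet nondeg, fun S => S.toBJSet_toModel nondeg⟩,
    fun X S b x y h => rfl, fun X S P hP hinf h x => rfl,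
    fun X Y SX SY f => isBJModelHom_iff SX SY f⟩
end

section
/- An algebraic theory 𝕋 presents a cartesian closed variety if and only if it is hyperaffine–unary; that is, the category of 𝕋-models and 𝕋-model homomorphisms is cartesian closed if and only if every operation t ∈ T(I) admits a unique decomposition t = h(λi. m) with h ∈ T(I) hyperaffine and m ∈ T(1). -/
/-- An (infinitary) algebraic theory. -/
structure AlgTheory where
  T : Type → Type
  pr : ∀ {I : Type}, I → T I
  subst : ∀ {I J : Type}, T I → (I → T J) → T J
  subst_pr : ∀ {I : Type} (t : T I), subst t (fun i => pr i) = t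
  pr_subst : ∀ {I J : Type} (i : I) (u : I → T J), subst (pr i) u = u i
  subst_assoc : ∀ {I J K : Type} (t : T I) (u : I → T J) (v : J → T K),
      subst (subst t u) v = subst t (fun i => subst (u i) v)

def AlgTheory.IsAffine (𝕋 : AlgTheory) {I : Type} (t : 𝕋.T I) : Prop :=
  𝕋.subst t (fun _ => 𝕋.pr PUnit.unit) = 𝕋.pr PUnit.unit

def AlgTheory.IsHyperaffine (𝕋 : AlgTheory) {I : Type} (t : 𝕋.T I) : Prop :=
  𝕋.IsAffine t ∧
  𝕋.subst t (fun i => 𝕋.subst t (fun j => 𝕋.pr (i, j))) =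
    𝕋.subst t (fun i => 𝕋.pr (i, i))

/-- `𝕋` is hyperaffine–unary: every operation `t` decomposes uniquely as
`t = h(λ i. m)` with `h` hyperaffine and `m` unary. -/
def AlgTheory.HyperaffineUnary (𝕋 : AlgTheory) : Prop :=
  ∀ (I : Type) (t : 𝕋.T I), ∃! p : 𝕋.T I × 𝕋.T PUnit,
    𝕋.IsHyperaffine p.1 ∧
    t = 𝕋.subst p.1 (fun i => 𝕋.subst p.2 (fun _ => 𝕋.pr i))

/-- A model of the algebraic theory `𝕋`. -/
structure TModel (𝕋 : AlgTheory) where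
  carrier : Type
  int : ∀ {I : Type}, 𝕋.T I → (I → carrier) → carrier
  int_pr : ∀ {I : Type} (i : I) (x : I → carrier), int (𝕋.pr i) x = x i
  int_subst : ∀ {I J : Type} (t : 𝕋.T I) (u : I → 𝕋.T J) (x : J → carrier),
      int (𝕋.subst t u) x = int t (fun i => int (u i) x)

/-- A homomorphism of `𝕋`-models. -/
def IsTModelHom {𝕋 : AlgTheory} (X Y : TModel 𝕋) (f : X.carrier → Y.carrier) : Prop :=
  ∀ (I : Type) (t : 𝕋.T I) (x : I → X.carrier), f (X.int t x) = Y.int t (fun i => f (x i))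

/-- The product of two `𝕋`-models, computed componentwise. -/
def prodTModel {𝕋 : AlgTheory} (X Y : TModel 𝕋) : TModel 𝕋 where
  carrier := X.carrier × Y.carrier
  int t x := (X.int t (fun i => (x i).1), Y.int t (fun i => (x i).2))
  int_pr i x := by simp [X.int_pr, Y.int_pr]
  int_subst t u x := by simp [X.int_subst, Y.int_subst]

/-- The variety of `𝕋`-models is cartesian closed: for all models `Y`, `Z`
there is a function-space model `E` with an evaluation homomorphism
`ev : E × Y → Z` through which every homomorphism `X × Y → Z` factors by a
unique homomorphism `X → E`. -/
def ModelsCartesianClosed (𝕋 : AlgTheory) : Prop :=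
  ∀ Y Z : TModel 𝕋, ∃ (E : TModel 𝕋) (ev : E.carrier × Y.carrier → Z.carrier),
    IsTModelHom (prodTModel E Y) Z ev ∧
    ∀ (X : TModel 𝕋) (f : X.carrier × Y.carrier → Z.carrier),
      IsTModelHom (prodTModel X Y) Z f →
      ∃! g : X.carrier → E.carrier,
        IsTModelHom X E g ∧ ∀ x y, ev (g x, y) = f (x, y)

namespace AlgTheory

variable {𝕋 : AlgTheory}

/-- The free model on `J`. -/
@[reducible] def free (𝕋 : AlgTheory) (J : Type) : TModel 𝕋 where
  carrier := 𝕋.T J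
  int t x := 𝕋.subst t x
  int_pr i x := 𝕋.pr_subst i x
  int_subst t u x := 𝕋.subst_assoc t u x

/-- The power of a model by a set, computed componentwise. -/
@[reducible] def power (Y : TModel 𝕋) (I : Type) : TModel 𝕋 where
  carrier := I → Y.carrier
  int t x := fun i => Y.int t (fun k => x k i)
  int_pr i x := by simp [Y.int_pr]
  int_subst t u x := by simp [Y.int_subst]

lemma IsAffine.int_const {I : Type} {h : 𝕋.T I} (hh : 𝕋.IsAffine h) (Y : TModel 𝕋)
    (y : Y.carrier) : Y.int h (fun _ => y) = y := by
  have := congrArg (fun s => Y.int s (fun _ => y)) hh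
  simpa [Y.int_subst, Y.int_pr] using this

lemma IsHyperaffine.int_diag {I : Type} {h : 𝕋.T I} (hh : 𝕋.IsHyperaffine h) (Y : TModel 𝕋)
    (z : I → I → Y.carrier) :
    Y.int h (fun i => Y.int h (fun j => z i j)) = Y.int h (fun i => z i i) := by
  have := congrArg (fun s => Y.int s (fun p => z p.1 p.2)) hh.2
  simpa [Y.int_subst, Y.int_pr] using this

lemma isAffine_pr {I : Type} (i : I) : 𝕋.IsAffine (𝕋.pr i) := by
  simp [IsAffine, 𝕋.pr_subst]

lemma IsAffine.subst {I J : Type} {h : 𝕋.T I} (hh : 𝕋.IsAffine h) {k : I → 𝕋.T J}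
    (hk : ∀ i, 𝕋.IsAffine (k i)) : 𝕋.IsAffine (𝕋.subst h k) := by
  unfold IsAffine at *
  simp [𝕋.subst_assoc, hk, hh]

lemma IsAffine.subst_const {I J : Type} {h : 𝕋.T I} (hh : 𝕋.IsAffine h) (m : 𝕋.T J) :
    𝕋.subst h (fun _ => m) = m :=
  hh.int_const (free 𝕋 J) m

/-- Substituting the same variable everywhere in `h(λ i. m)` gives back `m`. -/
lemma IsAffine.unary_part {I : Type} {h : 𝕋.T I} (hh : 𝕋.IsAffine h) (m : 𝕋.T PUnit) :
    𝕋.subst (𝕋.subst h (fun i => 𝕋.subst m (fun _ => 𝕋.pr i))) (fun _ => 𝕋.pr PUnit.unit) = m := by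
  simp only [𝕋.subst_assoc, 𝕋.pr_subst, 𝕋.subst_pr]
  exact hh.subst_const m

section Exponential

lemma HyperaffineUnary.isHyperaffine (H : 𝕋.HyperaffineUnary) {I : Type} {h : 𝕋.T I}
    (hh : 𝕋.IsAffine h) : 𝕋.IsHyperaffine h := by
  obtain ⟨⟨k, m⟩, ⟨hk, e⟩, -⟩ := H I h
  have hm : m = 𝕋.pr PUnit.unit := by
    refine ((hk.1.unary_part m).symm.trans ?_).trans hh
    exact congrArg (fun s => 𝕋.subst s (fun _ => 𝕋.pr PUnit.unit)) e.symm
  subst hm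
  simp only [𝕋.pr_subst, 𝕋.subst_pr] at e
  exact e ▸ hk

lemma HyperaffineUnary.int_comm (H : 𝕋.HyperaffineUnary) {I J : Type} {a : 𝕋.T I} {b : 𝕋.T J}
    (ha : 𝕋.IsAffine a) (hb : 𝕋.IsAffine b) (Y : TModel 𝕋) (z : I → J → Y.carrier) :
    Y.int a (fun i => Y.int b (fun j => z i j)) = Y.int b (fun j => Y.int a (fun i => z i j)) := by
  have hc := H.isHyperaffine (ha.subst (k := fun i => 𝕋.subst b (fun j => 𝕋.pr (i, j)))
    (fun i => hb.subst fun j => isAffine_pr _))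
  have := hc.int_diag Y (fun p q => z q.1 p.2)
  simp only [Y.int_subst, Y.int_pr, hb.int_const, ha.int_const] at this
  exact this.symm

lemma HyperaffineUnary.int_absorb (H : 𝕋.HyperaffineUnary) {I J : Type} {k : 𝕋.T J}
    {h : J → 𝕋.T I} (hk : 𝕋.IsAffine k) (hh : ∀ j, 𝕋.IsAffine (h j)) (Y : TModel 𝕋)
    (z : J → I → Y.carrier) :
    Y.int k (fun j => Y.int (h j) (fun i => Y.int k (fun j' => z j' i))) =
      Y.int k (fun j => Y.int (h j) (fun i => z j i)) := by
  have : ∀ j, Y.int (h j) (fun i => Y.int k (fun j' => z j' i)) =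
      Y.int k (fun j' => Y.int (h j) (fun i => z j' i)) := fun j =>
    H.int_comm (hh j) hk Y fun i j' => z j' i
  simp only [this]
  exact (H.isHyperaffine hk).int_diag Y (fun j j' => Y.int (h j) (fun i => z j' i))

/-- The hyperaffine part of an operation. -/
noncomputable def HyperaffineUnary.aff (H : 𝕋.HyperaffineUnary) {I : Type} (t : 𝕋.T I) : 𝕋.T I :=
  (H I t).choose.1

/-- The unary part of an operation. -/
noncomputable def HyperaffineUnary.un (H : 𝕋.HyperaffineUnary) {I : Type} (t : 𝕋.T I) :
    𝕋.T PUnit :=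
  (H I t).choose.2

lemma HyperaffineUnary.isAffine_aff (H : 𝕋.HyperaffineUnary) {I : Type} (t : 𝕋.T I) :
    𝕋.IsAffine (H.aff t) :=
  (H I t).choose_spec.1.1.1

lemma HyperaffineUnary.eq_subst (H : 𝕋.HyperaffineUnary) {I : Type} (t : 𝕋.T I) :
    t = 𝕋.subst (H.aff t) (fun i => 𝕋.subst (H.un t) (fun _ => 𝕋.pr i)) :=
  (H I t).choose_spec.1.2

lemma HyperaffineUnary.int_eq (H : 𝕋.HyperaffineUnary) {I : Type} (t : 𝕋.T I) (Y : TModel 𝕋)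
    (y : I → Y.carrier) : Y.int t y = Y.int (H.aff t) (fun i => Y.int (H.un t) (fun _ => y i)) := by
  conv_lhs => rw [H.eq_subst t]
  simp only [Y.int_subst, Y.int_pr]

lemma HyperaffineUnary.parts_eq (H : 𝕋.HyperaffineUnary) {I : Type} {t h : 𝕋.T I} {m : 𝕋.T PUnit}
    (hh : 𝕋.IsAffine h) (e : t = 𝕋.subst h (fun i => 𝕋.subst m (fun _ => 𝕋.pr i))) :
    H.aff t = h ∧ H.un t = m := by
  have := (H I t).choose_spec.2 (h, m) ⟨H.isHyperaffine hh, e⟩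
  exact ⟨congrArg Prod.fst this.symm, congrArg Prod.snd this.symm⟩

/-- The decomposition of `k(λ j. h_j(λ i. m_j))` for affine `k` and `h_j`. -/
lemma HyperaffineUnary.parts_subst (H : 𝕋.HyperaffineUnary) {I J : Type} {t : 𝕋.T I} {k : 𝕋.T J}
    {h : J → 𝕋.T I} {m : J → 𝕋.T PUnit} (hk : 𝕋.IsAffine k) (hh : ∀ j, 𝕋.IsAffine (h j))
    (e : t = 𝕋.subst k (fun j => 𝕋.subst (h j) (fun i => 𝕋.subst (m j) (fun _ => 𝕋.pr i)))) :
    H.aff t = 𝕋.subst k h ∧ H.un t = 𝕋.subst k m := by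
  refine H.parts_eq (hk.subst hh) (e.trans ?_)
  simp only [𝕋.subst_assoc]
  exact (H.int_absorb hk hh (free 𝕋 I) (fun j i => 𝕋.subst (m j) (fun _ => 𝕋.pr i))).symm

/-- The homomorphisms `T(1) × Y → Z`: the carrier of the exponential. -/
@[ext]
structure ExpCarrier (Y Z : TModel 𝕋) : Type where
  toFun : 𝕋.T PUnit × Y.carrier → Z.carrier
  isHom : IsTModelHom (prodTModel (free 𝕋 PUnit) Y) Z toFun

lemma ExpCarrier.map_int {Y Z : TModel 𝕋} (φ : ExpCarrier Y Z) {I : Type} (t : 𝕋.T I)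
    (n : I → 𝕋.T PUnit) (y : I → Y.carrier) :
    φ.1 (𝕋.subst t n, Y.int t y) = Z.int t (fun i => φ.1 (n i, y i)) :=
  φ.2 I t (fun i => (n i, y i))

lemma ExpCarrier.map_affine {Y Z : TModel 𝕋} (φ : ExpCarrier Y Z) {I : Type} {t : 𝕋.T I}
    (ht : 𝕋.IsAffine t) (n : I → 𝕋.T PUnit) (y : Y.carrier) :
    φ.1 (𝕋.subst t n, y) = Z.int t (fun i => φ.1 (n i, y)) := by
  rw [← φ.map_int t n (fun _ => y), ht.int_const]

lemma HyperaffineUnary.isTModelHom_expInt (H : 𝕋.HyperaffineUnary) {Y Z : TModel 𝕋} {I : Type}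
    (t : 𝕋.T I) (f : I → ExpCarrier Y Z) :
    IsTModelHom (prodTModel (free 𝕋 PUnit) Y) Z (fun p =>
      Z.int (H.aff (𝕋.subst p.1 (fun _ => t)))
        (fun i => (f i).1 (H.un (𝕋.subst p.1 (fun _ => t)), p.2))) := by
  intro J s x
  obtain ⟨n, y, rfl⟩ : ∃ (n : J → 𝕋.T PUnit) (y : J → Y.carrier), x = fun j => (n j, y j) :=
    ⟨fun j => (x j).1, fun j => (x j).2, rfl⟩
  change Z.int (H.aff (𝕋.subst (𝕋.subst s n) fun _ => t)) (fun i =>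
      (f i).1 (H.un (𝕋.subst (𝕋.subst s n) fun _ => t), Y.int s y)) =
    Z.int s (fun j => Z.int (H.aff (𝕋.subst (n j) fun _ => t)) (fun i =>
      (f i).1 (H.un (𝕋.subst (n j) fun _ => t), y j)))
  set k := H.aff s with hk
  set p := H.un s with hp
  set h : J → 𝕋.T I := fun j => H.aff (𝕋.subst (n j) fun _ => t)
  set m : J → 𝕋.T PUnit := fun j => H.un (𝕋.subst (n j) fun _ => t)
  set h' : J → 𝕋.T I := fun j => H.aff (𝕋.subst p fun _ => h j)
  have hun : ∀ j, H.un (𝕋.subst p fun _ => h j) = p := by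
    intro j
    have e := H.eq_subst (𝕋.subst p fun _ => h j)
    have := congrArg (fun q => 𝕋.subst q (fun _ => 𝕋.pr PUnit.unit)) e
    simp only [(H.isAffine_aff _).unary_part] at this
    rw [← this, 𝕋.subst_assoc]
    have : 𝕋.subst (h j) (fun _ => 𝕋.pr PUnit.unit) = 𝕋.pr PUnit.unit := H.isAffine_aff _
    rw [this]
    exact 𝕋.subst_pr p
  have swap : ∀ (W : TModel 𝕋) (j : J) (w : I → W.carrier),
      W.int p (fun _ => W.int (h j) w) = W.int (h' j) (fun i => W.int p (fun _ => w i)) := by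
    intro W j w
    rw [← W.int_subst p (fun _ => h j), H.int_eq, hun]
  have hd := H.parts_subst (t := 𝕋.subst (𝕋.subst s n) fun _ => t) (k := k) (h := h')
    (m := fun j => 𝕋.subst p (fun _ => m j)) (H.isAffine_aff _) (fun j => H.isAffine_aff _) (by
      rw [𝕋.subst_assoc]
      have e1 := H.int_eq s (free 𝕋 I) (fun j => 𝕋.subst (n j) fun _ => t)
      refine e1.trans ?_
      refine congrArg (𝕋.subst k) (funext fun j => ?_)
      conv_lhs => rw [H.eq_subst (𝕋.subst (n j) fun _ => t)]
      refine (swap (free 𝕋 I) j _).trans ?_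
      refine congrArg (𝕋.subst (h' j)) (funext fun i => ?_)
      exact (𝕋.subst_assoc _ _ _).symm)
  rw [hd.1, hd.2, H.int_eq s Y, H.int_eq s Z, Z.int_subst]
  simp only [← hk, ← hp, ExpCarrier.map_int]
  refine (H.int_absorb (H.isAffine_aff _) (fun j => H.isAffine_aff _) Z
    (fun j i => Z.int p (fun _ => (f i).1 (m j, y j)))).trans ?_
  exact congrArg (Z.int k) (funext fun j => (swap Z j (fun i => (f i).1 (m j, y j))).symm)

/-- The exponential `Z ^ Y` of models of a hyperaffine–unary theory. -/
noncomputable def HyperaffineUnary.exp (H : 𝕋.HyperaffineUnary) (Y Z : TModel 𝕋) : TModel 𝕋 where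
  carrier := ExpCarrier Y Z
  int t f := ⟨_, H.isTModelHom_expInt t f⟩
  int_pr {I} i f := by
    refine ExpCarrier.ext (funext fun p => ?_)
    have hd := H.parts_eq (t := 𝕋.subst p.1 (fun _ => 𝕋.pr i)) (h := 𝕋.pr i) (m := p.1)
      (isAffine_pr i) (by rw [𝕋.pr_subst])
    simp only [hd.1, hd.2, Z.int_pr]
  int_subst {I J} t u f := by
    refine ExpCarrier.ext (funext fun p => ?_)
    have hd := H.parts_subst (t := 𝕋.subst p.1 (fun _ => 𝕋.subst t u))
      (k := H.aff (𝕋.subst p.1 fun _ => t))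
      (h := fun i => H.aff (𝕋.subst (H.un (𝕋.subst p.1 fun _ => t)) (fun _ => u i)))
      (m := fun i => H.un (𝕋.subst (H.un (𝕋.subst p.1 fun _ => t)) (fun _ => u i)))
      (H.isAffine_aff _) (fun _ => H.isAffine_aff _) (by
        simp only [← H.eq_subst]
        rw [← 𝕋.subst_assoc]
        exact H.int_eq _ (free 𝕋 J) u)
    simp only [hd.1, hd.2, Z.int_subst, (f _).map_affine (H.isAffine_aff _)]
    exact H.int_absorb (H.isAffine_aff _) (fun j => H.isAffine_aff _) Z
      (fun i j => (f j).1 (H.un (𝕋.subst (H.un (𝕋.subst p.1 fun _ => t)) (fun _ => u i)), p.2))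

lemma HyperaffineUnary.exp_int_apply (H : 𝕋.HyperaffineUnary) {Y Z : TModel 𝕋} {I : Type}
    (t : 𝕋.T I) (f : I → ExpCarrier Y Z) (n : 𝕋.T PUnit) (y : Y.carrier) :
    ((H.exp Y Z).int t f).1 (n, y) = Z.int (H.aff (𝕋.subst n (fun _ => t)))
        (fun i => (f i).1 (H.un (𝕋.subst n (fun _ => t)), y)) :=
  rfl

lemma HyperaffineUnary.exp_int_unary (H : 𝕋.HyperaffineUnary) {Y Z : TModel 𝕋}
    (n : 𝕋.T PUnit) (φ : ExpCarrier Y Z) (y : Y.carrier) :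
    ((H.exp Y Z).int n (fun _ => φ)).1 (𝕋.pr PUnit.unit, y) = φ.1 (n, y) := by
  rw [H.exp_int_apply, 𝕋.pr_subst]
  have hd := H.parts_eq (t := n) (h := 𝕋.pr PUnit.unit) (m := n) (isAffine_pr _)
    (by rw [𝕋.pr_subst]; exact (𝕋.subst_pr n).symm)
  rw [hd.1, hd.2, Z.int_pr]

lemma HyperaffineUnary.isTModelHom_ev (H : 𝕋.HyperaffineUnary) (Y Z : TModel 𝕋) :
    IsTModelHom (prodTModel (H.exp Y Z) Y) Z
      (fun p : ExpCarrier Y Z × Y.carrier => p.1.1 (𝕋.pr PUnit.unit, p.2)) := by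
  intro I t x
  obtain ⟨φ, y, rfl⟩ : ∃ (φ : I → ExpCarrier Y Z) (y : I → Y.carrier), x = fun i => (φ i, y i) :=
    ⟨fun i => (x i).1, fun i => (x i).2, rfl⟩
  change ((H.exp Y Z).int t φ).1 (𝕋.pr PUnit.unit, Y.int t y) =
    Z.int t (fun i => (φ i).1 (𝕋.pr PUnit.unit, y i))
  refine (H.exp_int_apply t φ _ _).trans ?_
  rw [𝕋.pr_subst, H.int_eq t Z, H.int_eq t Y]
  have e (i i' : I) : (φ i).1 (H.un t, Y.int (H.un t) (fun _ => y i')) =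
      Z.int (H.un t) (fun _ => (φ i).1 (𝕋.pr PUnit.unit, y i')) := by
    rw [← ExpCarrier.map_int]
    rw [show 𝕋.subst (H.un t) (fun _ => 𝕋.pr PUnit.unit) = H.un t from 𝕋.subst_pr _]
  have e' (i : I) : (φ i).1 (H.un t,
        Y.int (H.aff t) (fun i' => Y.int (H.un t) (fun _ => y i'))) =
      Z.int (H.aff t) (fun i' => Z.int (H.un t)
        (fun _ => (φ i).1 (𝕋.pr PUnit.unit, y i'))) := by
    simp only [← e, ← ExpCarrier.map_int, (H.isAffine_aff t).subst_const]
  simp only [e']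
  exact (H.isHyperaffine (H.isAffine_aff t)).int_diag Z _

theorem HyperaffineUnary.modelsCartesianClosed (H : 𝕋.HyperaffineUnary) :
    ModelsCartesianClosed 𝕋 := by
  intro Y Z
  refine ⟨H.exp Y Z, fun p => p.1.1 (𝕋.pr PUnit.unit, p.2), H.isTModelHom_ev Y Z, ?_⟩
  intro X f hf
  have hf' : ∀ {I : Type} (t : 𝕋.T I) (x : I → X.carrier) (y : I → Y.carrier),
      f (X.int t x, Y.int t y) = Z.int t (fun i => f (x i, y i)) :=
    fun t x y => hf _ t (fun i => (x i, y i))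
  refine ⟨fun x => ⟨fun p => f (X.int p.1 (fun _ => x), p.2), ?_⟩, ⟨?_, ?_⟩, ?_⟩
  · intro J s q
    have := hf' s (fun j => X.int (q j).1 (fun _ => x)) (fun j => (q j).2)
    refine Eq.trans ?_ this
    exact congrArg (fun z => f (z, Y.int s (fun j => (q j).2))) (X.int_subst s _ _)
  · intro I t x
    refine ExpCarrier.ext (funext fun p => ?_)
    refine Eq.trans ?_ (H.exp_int_apply t _ p.1 p.2).symm
    have ha := H.isAffine_aff (𝕋.subst p.1 fun _ => t)
    rw [← hf' (H.aff (𝕋.subst p.1 fun _ => t)), ha.int_const, ← H.int_eq, X.int_subst]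
  · intro x y
    simp only [X.int_pr]
  · rintro g ⟨hg, hge⟩
    refine funext fun x => ExpCarrier.ext (funext fun p => ?_)
    change (g x).1 p = f (X.int p.1 (fun _ => x), p.2)
    rw [← hge, hg _ p.1 (fun _ => x)]
    exact (H.exp_int_unary p.1 (g x) p.2).symm

end Exponential

section Decomposition

lemma free_hom_ext (C : ModelsCartesianClosed 𝕋) {I : Type} {W Z : TModel 𝕋}
    {F G : 𝕋.T I × W.carrier → Z.carrier}
    (hF : IsTModelHom (prodTModel (free 𝕋 I) W) Z F)
    (hG : IsTModelHom (prodTModel (free 𝕋 I) W) Z G)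
    (e : ∀ i n w, F (𝕋.subst n (fun _ : PUnit => 𝕋.pr i), w) =
      G (𝕋.subst n (fun _ : PUnit => 𝕋.pr i), w)) : F = G := by
  obtain ⟨E, ev, hev, hu⟩ := C W Z
  obtain ⟨F', ⟨hF', eF⟩, -⟩ := hu (free 𝕋 I) F hF
  obtain ⟨G', ⟨hG', eG⟩, -⟩ := hu (free 𝕋 I) G hG
  have key (i : I) : F' (𝕋.pr i) = G' (𝕋.pr i) := by
    have hom : IsTModelHom (prodTModel (free 𝕋 PUnit) W) Z
        (fun p : 𝕋.T PUnit × W.carrier => F (𝕋.subst p.1 (fun _ => 𝕋.pr i), p.2)) := by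
      intro J s x
      have := hF J s (fun j => (𝕋.subst (x j).1 (fun _ => 𝕋.pr i), (x j).2))
      refine Eq.trans ?_ this
      exact congrArg (fun q => F (q, W.int s (fun j => (x j).2))) (𝕋.subst_assoc _ _ _)
    have h1 : ∀ {A : 𝕋.T I → E.carrier}, IsTModelHom (free 𝕋 I) E A →
        IsTModelHom (free 𝕋 PUnit) E (fun n : 𝕋.T PUnit => A (𝕋.subst n (fun _ => 𝕋.pr i))) := by
      intro A hA J s x
      refine Eq.trans ?_ (hA J s (fun j => 𝕋.subst (x j) (fun _ => 𝕋.pr i)))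
      exact congrArg A (𝕋.subst_assoc _ _ _)
    have := (hu (free 𝕋 PUnit) _ hom).unique ⟨h1 hF', fun n y => eF _ _⟩
      ⟨h1 hG', fun n y => (eG _ _).trans (e _ _ _).symm⟩
    have := congrFun this (𝕋.pr PUnit.unit)
    simpa only [𝕋.pr_subst] using this
  funext ⟨t, w⟩
  have hF'' := hF' I t 𝕋.pr
  have hG'' := hG' I t 𝕋.pr
  refine (eF t w).symm.trans (Eq.trans ?_ (eG t w))
  rw [show (free 𝕋 I).int t 𝕋.pr = t from 𝕋.subst_pr t] at hF'' hG''
  rw [hF'', hG'']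
  simp only [key]

lemma exists_free_hom (C : ModelsCartesianClosed 𝕋) (I : Type) (Y : TModel 𝕋) :
    ∃ θ : 𝕋.T I × (I → Y.carrier) → Y.carrier,
      IsTModelHom (prodTModel (free 𝕋 I) (power Y I)) Y θ ∧
      ∀ i n y, θ (𝕋.subst n (fun _ : PUnit => 𝕋.pr i), y) = y i := by
  obtain ⟨E, ev, hev, hu⟩ := C (power Y I) Y
  have hi (i : I) := (hu (free 𝕋 PUnit) (fun p => p.2 i) (fun J s x => rfl)).exists
  choose g hg hge using hi
  refine ⟨fun p => ev (E.int p.1 (fun i => g i (𝕋.pr PUnit.unit)), p.2), ?_, ?_⟩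
  · intro J s x
    refine Eq.trans ?_ (hev J s
      (fun j => (E.int (x j).1 (fun i => g i (𝕋.pr PUnit.unit)), (x j).2)))
    exact congrArg (fun q => ev (q, (power Y I).int s (fun j => (x j).2))) (E.int_subst _ _ _)
  · intro i n y
    have := hg i _ n (fun _ => 𝕋.pr PUnit.unit)
    rw [show (free 𝕋 PUnit).int n (fun _ => 𝕋.pr PUnit.unit) = n from 𝕋.subst_pr n] at this
    simp only [E.int_subst, E.int_pr, ← this]
    exact hge i n y

lemma exists_hyperaffine_part (C : ModelsCartesianClosed 𝕋) (I : Type) :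
    ∃ h : 𝕋.T I → 𝕋.T I,
      (∀ Y : TModel 𝕋, IsTModelHom (prodTModel (free 𝕋 I) (power Y I)) Y
        (fun p : 𝕋.T I × (I → Y.carrier) => Y.int (h p.1) p.2)) ∧
      ∀ i n, h (𝕋.subst n (fun _ : PUnit => 𝕋.pr i)) = 𝕋.pr i := by
  obtain ⟨θ, hθ, eθ⟩ := exists_free_hom C I (free 𝕋 I)
  refine ⟨fun t => θ (t, 𝕋.pr), fun Y => ?_, fun i n => eθ i n _⟩
  obtain ⟨η, hη, eη⟩ := exists_free_hom C I Y
  suffices h : ∀ t y, Y.int (θ (t, 𝕋.pr)) y = η (t, y) by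
    simpa only [h] using hη
  intro t y
  have ext := free_hom_ext C (I := I) (W := free 𝕋 PUnit) (Z := Y)
    (F := fun p : 𝕋.T I × 𝕋.T PUnit => Y.int (θ (p.1, fun i => 𝕋.subst p.2 (fun _ => 𝕋.pr i))) y)
    (G := fun p : 𝕋.T I × 𝕋.T PUnit => η (p.1, fun i => Y.int p.2 (fun _ => y i)))
    (by
      intro J s x
      have := hθ J s (fun j => ((x j).1, fun i => 𝕋.subst (x j).2 (fun _ => 𝕋.pr i)))
      refine Eq.trans ?_ ((congrArg (fun q => Y.int q y) this).trans (Y.int_subst _ _ _))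
      refine congrArg (fun q => Y.int (θ (𝕋.subst s (fun j => (x j).1), q)) y) ?_
      exact funext fun i => 𝕋.subst_assoc _ _ _)
    (by
      intro J s x
      refine Eq.trans ?_ (hη J s (fun j => ((x j).1, fun i => Y.int (x j).2 (fun _ => y i))))
      refine congrArg (fun q => η (𝕋.subst s (fun j => (x j).1), q)) ?_
      exact funext fun i => Y.int_subst _ _ _)
    (fun i n m => by simp only [eθ, eη, Y.int_subst, Y.int_pr])
  simpa only [𝕋.pr_subst, Y.int_pr] using congrFun ext (t, 𝕋.pr PUnit.unit)

end Decomposition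

end AlgTheory

open AlgTheory in
theorem ModelsCartesianClosed.hyperaffineUnary {𝕋 : AlgTheory} (C : ModelsCartesianClosed 𝕋) :
    𝕋.HyperaffineUnary := by
  intro I t
  obtain ⟨h, hom, hpr⟩ := exists_hyperaffine_part C I
  have hom' : ∀ (Y : TModel 𝕋) {J : Type} (s : 𝕋.T J) (x : J → 𝕋.T I) (y : J → I → Y.carrier),
      Y.int (h (𝕋.subst s x)) (fun i => Y.int s (fun j => y j i)) =
        Y.int s (fun j => Y.int (h (x j)) (y j)) :=
    fun Y J s x y => hom Y J s (fun j => (x j, y j))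
  have aff : 𝕋.IsAffine (h t) := by
    have ext := free_hom_ext C (I := I) (W := free 𝕋 PUnit) (Z := free 𝕋 PUnit)
      (F := fun p : 𝕋.T I × 𝕋.T PUnit => 𝕋.subst (h p.1) (fun _ => p.2))
      (G := fun p => p.2)
      (fun J s x => hom' (free 𝕋 PUnit) s (fun j => (x j).1) (fun j _ => (x j).2))
      (fun J s x => rfl)
      (fun i n m => by simp only [hpr, 𝕋.pr_subst])
    exact congrFun ext (t, 𝕋.pr PUnit.unit)
  have diag : 𝕋.subst (h t) (fun i => 𝕋.subst (h t) (fun j => 𝕋.pr (i, j))) =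
      𝕋.subst (h t) (fun i => 𝕋.pr (i, i)) := by
    have ext := free_hom_ext C (I := I) (W := power (free 𝕋 (I × I)) (I × I))
      (Z := free 𝕋 (I × I))
      (F := fun p : 𝕋.T I × (I × I → 𝕋.T (I × I)) =>
        𝕋.subst (h p.1) (fun i => 𝕋.subst (h p.1) (fun j => p.2 (i, j))))
      (G := fun p : 𝕋.T I × (I × I → 𝕋.T (I × I)) => 𝕋.subst (h p.1) (fun i => p.2 (i, i)))
      (by
        intro J s x
        refine Eq.trans ?_ (hom' (free 𝕋 (I × I)) s (fun j => (x j).1)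
          (fun k i => 𝕋.subst (h (x k).1) (fun j => (x k).2 (i, j))))
        refine congrArg (𝕋.subst (h (𝕋.subst s (fun j => (x j).1)))) (funext fun i => ?_)
        exact hom' (free 𝕋 (I × I)) s (fun j => (x j).1) (fun k j => (x k).2 (i, j)))
      (fun J s x => hom' (free 𝕋 (I × I)) s (fun j => (x j).1) (fun k i => (x k).2 (i, i)))
      (fun i n z => by simp only [hpr, 𝕋.pr_subst])
    exact congrFun ext (t, 𝕋.pr)
  refine ⟨(h t, 𝕋.subst t (fun _ => 𝕋.pr PUnit.unit)), ⟨⟨aff, diag⟩, ?_⟩, ?_⟩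
  · have := hom' (free 𝕋 I) t 𝕋.pr (fun _ => 𝕋.pr)
    rw [show 𝕋.subst t 𝕋.pr = t from 𝕋.subst_pr t] at this
    have e (j : I) : 𝕋.subst (h (𝕋.pr j)) 𝕋.pr = 𝕋.pr j := by
      have := hpr j (𝕋.pr PUnit.unit)
      rw [𝕋.pr_subst] at this
      rw [this]
      exact 𝕋.pr_subst _ _
    have e' := congrArg (𝕋.subst t) (funext e)
    refine ((𝕋.subst_pr t).symm.trans (e'.symm.trans this.symm)).trans ?_
    refine congrArg (𝕋.subst (h t)) (funext fun i => ?_)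
    simp only [𝕋.subst_assoc, 𝕋.pr_subst]
  · rintro ⟨k, m⟩ ⟨⟨hk, -⟩, rfl⟩
    refine Prod.ext ?_ (hk.unary_part m).symm
    have := hom' (free 𝕋 I) k (fun i => 𝕋.subst m (fun _ => 𝕋.pr i)) (fun _ => 𝕋.pr)
    simp only [hpr, hk.subst_const, 𝕋.pr_subst, 𝕋.subst_pr] at this
    exact this.symm

/-- An algebraic theory presents a cartesian closed variety if and only if it
is hyperaffine–unary. -/
theorem cartesianClosed_iff_hyperaffineUnary (𝕋 : AlgTheory) :
    ModelsCartesianClosed 𝕋 ↔ 𝕋.HyperaffineUnary := by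
  exact ⟨fun C => C.hyperaffineUnary, fun H => H.modelsCartesianClosed⟩
end
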